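/- arXiv:2105.11620 — 3 statements merged into one kernel-verified Lean document; each statement's English description precedes it below -/
import Mathlib

section
/- Fix n ≥ 2 and a sortable preference family f : Fin n → Fin n → ℝ. Then for every m with m + 1 < n: (i) the number of indices i ∈ Fin n with f i m ≥ f i (m+1) is at least m + 1; (ii) the number of indices i ∈ Fin n with f i (m+1) ≥ f i m is at least n − m − 1; and (iii) the number of indices i ∈ Fin n with f i m ≠ f i (m+1) is at least n − 2. -/
/-- In a sortable preference family on `n` candidates, comparing the candidates `m` and `m+1`:
the teacher's response `m` better removes at least `m+1` candidates, response `m+1` better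
removes at least `n - m - 1` candidates, and response "equal" removes at least `n - 2`. -/
theorem stmt_7 (n : ℕ) (hn : 2 ≤ n) (f : Fin n → Fin n → ℝ)
    (hself : ∀ i j : Fin n, f i j ≤ f i i)
    (hsort : ∀ i j k : Fin n, i < j → j < k → f i j > f i k ∧ f k j > f k i)
    (m : ℕ) (hm : m + 1 < n) :
    m + 1 ≤ {i : Fin n | f i ⟨m, by omega⟩ ≥ f i ⟨m + 1, hm⟩}.ncard ∧
    n - m - 1 ≤ {i : Fin n | f i ⟨m + 1, hm⟩ ≥ f i ⟨m, by omega⟩}.ncard ∧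
    n - 2 ≤ {i : Fin n | f i ⟨m, by omega⟩ ≠ f i ⟨m + 1, hm⟩}.ncard := by
  have hlt : (⟨m, by omega⟩ : Fin n) < ⟨m + 1, hm⟩ := Nat.lt_succ_self m
  have hlow : ∀ i : Fin n, i < ⟨m, by omega⟩ → f i ⟨m + 1, hm⟩ < f i ⟨m, by omega⟩ :=
    fun i hi => (hsort i _ _ hi hlt).1
  have hhigh : ∀ i : Fin n, ⟨m + 1, hm⟩ < i → f i ⟨m, by omega⟩ < f i ⟨m + 1, hm⟩ :=
    fun i hi => (hsort _ _ i hlt hi).2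
  have card_le : ∀ (s : Finset (Fin n)) (t : Set (Fin n)), (∀ i ∈ s, i ∈ t) → s.card ≤ t.ncard :=
    fun s t h => Set.ncard_coe_finset s ▸ Set.ncard_le_ncard h t.toFinite
  refine ⟨?_, ?_, ?_⟩
  · refine (Fin.card_Iic (⟨m, by omega⟩ : Fin n)).ge.trans (card_le _ _ fun i hi => ?_)
    rcases (Finset.mem_Iic.mp hi).lt_or_eq with h | rfl
    · exact (hlow i h).le
    · exact hself _ _
  · rw [Nat.sub_sub, ← Fin.card_Ici (⟨m + 1, hm⟩ : Fin n)]
    refine card_le _ _ fun i hi => ?_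
    rcases (Finset.mem_Ici.mp hi).lt_or_eq with h | rfl
    · exact (hhigh i h).le
    · exact hself _ _
  · have hcard : n - 2 = ({⟨m, by omega⟩, ⟨m + 1, hm⟩}ᶜ : Finset (Fin n)).card := by
      rw [Finset.card_compl, Fintype.card_fin, Finset.card_pair hlt.ne]
    rw [hcard]
    refine card_le _ _ fun i hi => ?_
    simp only [Finset.mem_compl, Finset.mem_insert, Finset.mem_singleton, Fin.ext_iff, not_or] at hi
    rcases Nat.lt_or_gt_of_ne hi.1 with h | h
    · exact (hlow i h).ne'
    · exact (hhigh i (lt_of_le_of_ne h (Ne.symm (Fin.ne_of_val_ne hi.2)))).ne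
end

section
/- Fix n ≥ 2 and a sortable preference family f : Fin n → Fin n → ℝ, and let m = ⌊n/2⌋ − 1 ∈ Fin n. Then both the number of indices i ∈ Fin n with f i m ≥ f i (m+1) and the number of indices i ∈ Fin n with f i (m+1) ≥ f i m are at least ⌊n/2⌋. -/
/-- In a sortable preference family on `n ≥ 2` candidates, comparing the two middle candidates
`⌊n/2⌋ - 1` and `⌊n/2⌋`, each of the two strict teacher responses removes at least `⌊n/2⌋`
candidates. -/
theorem stmt_8 (n : ℕ) (hn : 2 ≤ n) (f : Fin n → Fin n → ℝ)
    (hself : ∀ i j : Fin n, f i j ≤ f i i)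
    (hsort : ∀ i j k : Fin n, i < j → j < k → f i j > f i k ∧ f k j > f k i) :
    n / 2 ≤ {i : Fin n | f i ⟨n / 2 - 1, by omega⟩ ≥ f i ⟨n / 2, by omega⟩}.ncard ∧
    n / 2 ≤ {i : Fin n | f i ⟨n / 2, by omega⟩ ≥ f i ⟨n / 2 - 1, by omega⟩}.ncard := by
  set a : Fin n := ⟨n / 2 - 1, by omega⟩ with ha
  set b : Fin n := ⟨n / 2, by omega⟩ with hb
  have hab : a < b := by
    rw [ha, hb, Fin.mk_lt_mk]
    omega
  constructor
  · have hsub : (↑(Finset.Iio b) : Set (Fin n)) ⊆ {i | f i a ≥ f i b} := by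
      intro i hi
      have hib : i < b := by simpa using hi
      have hia : i ≤ a := by
        rw [hb, Fin.lt_def] at hib
        rw [ha, Fin.le_def]
        simp only at hib ⊢
        omega
      rcases hia.eq_or_lt with rfl | hlt
      · exact hself _ _
      · exact (hsort i a b hlt hab).1.le
    have hcard := Set.ncard_le_ncard hsub (Set.toFinite _)
    rwa [Set.ncard_coe_finset, Fin.card_Iio] at hcard
  · have hsub : (↑(Finset.Ici b) : Set (Fin n)) ⊆ {i | f i b ≥ f i a} := by
      intro i hi
      have hbi : b ≤ i := by simpa using hi
      rcases hbi.eq_or_lt with rfl | hlt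
      · exact hself _ _
      · exact (hsort a b i hab hlt).2.le
    have hcard := Set.ncard_le_ncard hsub (Set.toFinite _)
    rw [Set.ncard_coe_finset, Fin.card_Ici] at hcard
    exact le_trans (by rw [hb]; simp only; omega) hcard
end

section
/- For every natural number n ≥ 1 there exists a function f : Fin n → Fin n → ℝ such that: (i) each row is injective (for all i and j ≠ k, f i j ≠ f i k); (ii) each objective strictly prefers its own candidate (for all i and j ≠ i, f i j < f i i); and (iii) for all j < k in Fin n, the set of indices i with f i k > f i j is exactly the singleton {k}. -/
/-- For every `n ≥ 1` there is a preference family on `n` candidates in which every row is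
injective, every objective strictly prefers its own candidate, and for every pair `j < k`
only the `k`-th objective prefers candidate `k` to candidate `j`. -/
theorem stmt_9 (n : ℕ) (hn : 1 ≤ n) :
    ∃ f : Fin n → Fin n → ℝ,
      (∀ i j k : Fin n, j ≠ k → f i j ≠ f i k) ∧
      (∀ i j : Fin n, j ≠ i → f i j < f i i) ∧
      (∀ j k : Fin n, j < k → {i : Fin n | f i k > f i j} = {k}) := by
  have hnn : ∀ j : Fin n, (0 : ℝ) ≤ (j : ℕ) := fun j => Nat.cast_nonneg _
  refine ⟨fun i j => if j = i then 1 else -((j : ℕ) : ℝ), ?_, ?_, ?_⟩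
  · intro i j k hjk
    have hval : ((j : ℕ) : ℝ) ≠ (k : ℕ) := fun h => hjk (Fin.ext (Nat.cast_injective h))
    have hj := hnn j
    have hk := hnn k
    dsimp only
    split_ifs <;> grind
  · intro i j hji
    have hj := hnn j
    simp only [if_neg hji, if_true]
    linarith
  · intro j k hjk
    have hlt : ((j : ℕ) : ℝ) < (k : ℕ) := Nat.cast_lt.mpr hjk
    have hj := hnn j
    ext i
    simp only [Set.mem_ofPred_eq, Set.mem_singleton_iff, gt_iff_lt]
    have hne := hjk.ne
    split_ifs <;> grind
end
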